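/- If f : X → Y is a function between topological spaces such that there exists a countable cover (Z_i) of X by Π⁰_{n-1} subsets of X with each restriction f↾Z_i being Σ⁰_{n-m+1}-measurable (with 1 ≤ m ≤ n), then for every Σ⁰_m set A ⊆ Y, the preimage f⁻¹[A] is a Σ⁰_n subset of X. -/

import Mathlib

/-- The finite additive levels of the Borel hierarchy: `Sigma0 X 1` is the class
of open sets, `Sigma0 X (n+1)` the class of countable unions of complements of
`Sigma0 X n` sets; at level `0` we take the clopen (`Δ⁰₁`) sets. -/
def Sigma0 (X : Type*) [TopologicalSpace X] : ℕ → Set (Set X)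
  | 0 => {S | IsOpen S ∧ IsClosed S}
  | 1 => {S | IsOpen S}
  | (n + 2) => {S | ∃ A : ℕ → Set X, (∀ i, A i ∈ Sigma0 X (n + 1)) ∧ S = ⋃ i, (A i)ᶜ}

/-- The finite multiplicative levels of the Borel hierarchy. -/
def Pi0 (X : Type*) [TopologicalSpace X] (n : ℕ) : Set (Set X) :=
  {S | Sᶜ ∈ Sigma0 X n}

theorem iUnion_mem_sigma0 {X : Type*} [TopologicalSpace X] {n : ℕ} {A : ℕ → Set X}
    (hA : ∀ i, A i ∈ Sigma0 X (n + 1)) : (⋃ i, A i) ∈ Sigma0 X (n + 1) := by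
  cases n with
  | zero => exact isOpen_iUnion hA
  | succ n =>
    choose B hB hAB using hA
    refine ⟨fun k => B k.unpair.1 k.unpair.2, fun k => hB _ _, ?_⟩
    rw [Set.iUnion_unpair fun i j => (B i j)ᶜ]
    exact Set.iUnion_congr hAB

theorem union_mem_sigma0 {X : Type*} [TopologicalSpace X] {n : ℕ} {A B : Set X}
    (hA : A ∈ Sigma0 X (n + 1)) (hB : B ∈ Sigma0 X (n + 1)) : A ∪ B ∈ Sigma0 X (n + 1) := by
  have h : (⋃ i : ℕ, if i = 0 then A else B) = A ∪ B := by
    ext x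
    simp only [Set.mem_iUnion, Set.mem_union]
    constructor
    · rintro ⟨i, hi⟩
      split_ifs at hi
      exacts [Or.inl hi, Or.inr hi]
    · rintro (hx | hx)
      exacts [⟨0, by simpa using hx⟩, ⟨1, by simpa using hx⟩]
  rw [← h]
  refine iUnion_mem_sigma0 fun i => ?_
  split_ifs <;> assumption

theorem inter_pi0_mem_sigma0 {X : Type*} [TopologicalSpace X] {n : ℕ} {S Z : Set X}
    (hS : S ∈ Sigma0 X (n + 1)) (hZ : Z ∈ Pi0 X n) : S ∩ Z ∈ Sigma0 X (n + 1) := by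
  cases n with
  | zero => exact IsOpen.inter hS (isClosed_compl_iff.mp hZ.2)
  | succ n =>
    obtain ⟨A, hA, rfl⟩ := hS
    refine ⟨fun i => A i ∪ Zᶜ, fun i => union_mem_sigma0 (hA i) hZ, ?_⟩
    simp only [Set.compl_union, compl_compl, Set.iUnion_inter]

/-- A function that is relatively `Σ⁰_{k+1}`-measurable on `Z` pulls `Σ⁰_{m+1}` sets back to
relatively `Σ⁰_{m+k+1}` subsets of `Z`. -/
theorem exists_sigma0_preimage_inter_eq {X Y : Type*} [TopologicalSpace X] [TopologicalSpace Y]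
    {f : X → Y} {Z : Set X} {k : ℕ}
    (hf : ∀ U : Set Y, IsOpen U → ∃ S ∈ Sigma0 X (k + 1), f ⁻¹' U ∩ Z = S ∩ Z) (m : ℕ) :
    ∀ A ∈ Sigma0 Y (m + 1), ∃ S ∈ Sigma0 X (m + k + 1), f ⁻¹' A ∩ Z = S ∩ Z := by
  induction m with
  | zero =>
    rw [Nat.zero_add k]
    exact hf
  | succ m ih =>
    rintro _ ⟨A, hA, rfl⟩
    choose S hS hSA using fun i => ih (A i) (hA i)
    rw [Nat.succ_add_eq_add_succ m k]
    refine ⟨⋃ i, (S i)ᶜ, ⟨S, hS, rfl⟩, ?_⟩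
    ext x
    simp only [Set.mem_inter_iff, Set.mem_preimage, Set.mem_iUnion, Set.mem_compl_iff,
      and_congr_left_iff]
    intro hx
    refine exists_congr fun i => not_congr ?_
    have h := Set.ext_iff.mp (hSA i) x
    simpa [hx] using h

/-- If `f : X → Y` admits a countable cover of `X` by `Π⁰_{n-1}` sets on each of
which it restricts to a `Σ⁰_{n-m+1}`-measurable function (`1 ≤ m ≤ n`), then the
`f`-preimage of every `Σ⁰_m` set is `Σ⁰_n`. -/
theorem preimage_sigma0_of_decomposition
    {X Y : Type*} [TopologicalSpace X] [TopologicalSpace Y]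
    [TopologicalSpace.MetrizableSpace X] [TopologicalSpace.MetrizableSpace Y]
    (f : X → Y) (m n : ℕ) (hm : 1 ≤ m) (hmn : m ≤ n)
    (Z : ℕ → Set X) (hcover : (⋃ i, Z i) = Set.univ)
    (hZ : ∀ i, Z i ∈ Pi0 X (n - 1))
    (hmeas : ∀ i, ∀ U : Set Y, IsOpen U →
      ∃ S ∈ Sigma0 X (n - m + 1), f ⁻¹' U ∩ Z i = S ∩ Z i) :
    ∀ A ∈ Sigma0 Y m, f ⁻¹' A ∈ Sigma0 X n := by
  intro A hA
  obtain ⟨m, rfl⟩ := Nat.exists_eq_add_of_le' hm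
  obtain ⟨k, rfl⟩ := Nat.exists_eq_add_of_le hmn
  rw [Nat.add_sub_cancel_left] at hmeas
  rw [Nat.add_right_comm] at hZ ⊢
  choose S hS hSA using fun i => exists_sigma0_preimage_inter_eq (hmeas i) m A hA
  have h : f ⁻¹' A = ⋃ i, S i ∩ Z i := by
    rw [← Set.iUnion_congr hSA, ← Set.inter_iUnion, hcover, Set.inter_univ]
  rw [h]
  exact iUnion_mem_sigma0 fun i => inter_pi0_mem_sigma0 (hS i) (hZ i)
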